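/- arXiv:2501.08846 — 8 statements merged into one kernel-verified Lean document; each statement's English description precedes it below -/
import Mathlib

section
/- There exists an integer G such that for all integers g ≥ G, the number x_g satisfies 1 - (ln g)/(g-1) ≤ x_g ≤ 1 - 1/(g-1). -/
/-- A root of `t ^ n + t = 1` in `[0, 1]` is at least `1 - log (n + 1) / n`. -/
lemma one_sub_log_div_le_of_pow_add_self_eq_one {t : ℝ} {n : ℕ} (hn : 0 < n)
    (ht0 : 0 ≤ t) (ht : t ^ n + t = 1) : 1 - Real.log (n + 1) / n ≤ t := by
  have hn' : (0 : ℝ) < n := by exact_mod_cast hn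
  by_contra! hlt
  have hlog : Real.log (n + 1) < n * (1 - t) := by
    have h := (div_lt_iff₀ hn').1 (show Real.log (n + 1) / n < 1 - t by linarith)
    linarith
  have hpow : t ^ n < ((n : ℝ) + 1)⁻¹ := by
    calc t ^ n ≤ Real.exp (t - 1) ^ n := by
          gcongr
          linarith [Real.add_one_le_exp (t - 1)]
      _ = Real.exp (n * (t - 1)) := (Real.exp_nat_mul _ _).symm
      _ < Real.exp (-Real.log (n + 1)) := Real.exp_lt_exp.2 (by linarith)
      _ = ((n : ℝ) + 1)⁻¹ := by rw [Real.exp_neg, Real.exp_log (by positivity)]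
  have hbound := Real.one_sub_inv_le_log_of_pos (show (0 : ℝ) < n + 1 by positivity)
  have hinv : (n : ℝ) * ((n : ℝ) + 1)⁻¹ = 1 - ((n : ℝ) + 1)⁻¹ := by field_simp; ring
  have hmul := mul_lt_mul_of_pos_left (show 1 - t < ((n : ℝ) + 1)⁻¹ by linarith) hn'
  linarith

/-- For `n ≥ 9`, a real solution of `t ^ n + t = 1` is at most `1 - 1 / n`. -/
lemma le_one_sub_one_div_of_pow_add_self_eq_one {t : ℝ} {n : ℕ} (hn : 9 ≤ n)
    (ht : t ^ n + t = 1) : t ≤ 1 - 1 / n := by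
  have hn9 : (9 : ℝ) ≤ n := by exact_mod_cast hn
  have hn' : (0 : ℝ) < n := by linarith
  by_contra! hlt
  have hn1 : 1 / (n : ℝ) ≤ 1 / 9 := one_div_le_one_div_of_le (by norm_num) hn9
  have htpos : 0 < t := by linarith
  have hy : n * (1 - t) < 1 := by
    have h := (lt_div_iff₀ hn').1 (show 1 - t < 1 / n by linarith)
    linarith
  have hlog : -2 ≤ n * Real.log t := by
    have h := mul_le_mul_of_nonneg_left (Real.one_sub_inv_le_log_of_pos htpos) hn'.le
    have h' : -2 ≤ n * (1 - t⁻¹) := by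
      have e : n * (1 - t⁻¹) = -(n * (1 - t)) / t := by field_simp; ring
      rw [e, le_div_iff₀ htpos]
      linarith
    linarith
  have hpow : Real.exp (-2) ≤ t ^ n := by
    calc Real.exp (-2) ≤ Real.exp (n * Real.log t) := Real.exp_le_exp.2 hlog
      _ = t ^ n := by rw [Real.exp_nat_mul, Real.exp_log htpos]
  have hexp : 1 / 9 ≤ Real.exp (-2) := by
    rw [Real.exp_neg, ← one_div]
    refine one_div_le_one_div_of_le (Real.exp_pos _) ?_
    rw [show (2 : ℝ) = 1 + 1 by norm_num, Real.exp_add]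
    nlinarith [Real.exp_one_lt_d9, Real.exp_pos 1]
  linarith


/-- For each integer g ≥ 2 let x_g be the unique root in [0,1] of x^(g-1) + x = 1.
Then there exists an integer G such that for all g ≥ G,
1 - (ln g)/(g-1) ≤ x_g ≤ 1 - 1/(g-1). -/
theorem stmt_1 (x : ℕ → ℝ)
    (hx : ∀ g : ℕ, 2 ≤ g → 0 ≤ x g ∧ x g ≤ 1 ∧ x g ^ (g - 1) + x g = 1) :
    ∃ G : ℕ, 2 ≤ G ∧ ∀ g : ℕ, G ≤ g →
      1 - Real.log g / ((g : ℝ) - 1) ≤ x g ∧ x g ≤ 1 - 1 / ((g : ℝ) - 1) := by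
  refine ⟨10, by norm_num, fun g hg => ?_⟩
  obtain ⟨h0, -, heq⟩ := hx g (by omega)
  obtain ⟨n, rfl⟩ : ∃ n, g = n + 1 := ⟨g - 1, by omega⟩
  rw [Nat.add_sub_cancel] at heq
  push_cast
  rw [add_sub_cancel_right]
  exact ⟨one_sub_log_div_le_of_pow_add_self_eq_one (by omega) h0 heq,
    le_one_sub_one_div_of_pow_add_self_eq_one (by omega) heq⟩
end

section
/- For every integer i ≥ m', the function h satisfies the closed-form identity h(i) = m'(m'-1)/(i(i-1)) + Σ_{j=m'+1}^{i} [ j(j-1)/(i(i-1)) ] · (δ/j) · [ m'(m'-1)/((j-1)(j-2)) ] · (1 - m'/(j-1)). -/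
/-- Closed form for the recursively defined h: for all i ≥ m',
h(i) = m'(m'-1)/(i(i-1)) + Σ_{j=m'+1}^i (j(j-1)/(i(i-1)))·(δ/j)·(m'(m'-1)/((j-1)(j-2)))·(1 - m'/(j-1)). -/
theorem stmt_9 (m' : ℕ) (hm' : 3 ≤ m') (δ : ℝ) (h : ℕ → ℝ)
    (hbase : h m' = 1)
    (hrec : ∀ i : ℕ, m' < i →
      h i = (1 - 2 / (i : ℝ)) * h (i - 1) +
        (δ / (i : ℝ)) * ((m' : ℝ) * ((m' : ℝ) - 1) / (((i : ℝ) - 1) * ((i : ℝ) - 2))) *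
          (1 - (m' : ℝ) / ((i : ℝ) - 1))) :
    ∀ i : ℕ, m' ≤ i →
      h i = (m' : ℝ) * ((m' : ℝ) - 1) / ((i : ℝ) * ((i : ℝ) - 1)) +
        ∑ j ∈ Finset.Icc (m' + 1) i,
          ((j : ℝ) * ((j : ℝ) - 1) / ((i : ℝ) * ((i : ℝ) - 1))) * (δ / (j : ℝ)) *
            ((m' : ℝ) * ((m' : ℝ) - 1) / (((j : ℝ) - 1) * ((j : ℝ) - 2))) *
            (1 - (m' : ℝ) / ((j : ℝ) - 1)) := by
  intro i hi
  induction i, hi using Nat.le_induction with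
  | base =>
    have hm : (3 : ℝ) ≤ m' := by exact_mod_cast hm'
    have hprod : (m' : ℝ) * ((m' : ℝ) - 1) ≠ 0 := by
      apply mul_ne_zero <;> linarith
    rw [hbase, Finset.Icc_eq_empty (by omega), Finset.sum_empty, div_self hprod, add_zero]
  | succ n hn ih =>
    have hn3 : (3 : ℝ) ≤ n := by exact_mod_cast hm'.trans hn
    have hn0 : (n : ℝ) ≠ 0 := by linarith
    have hn1 : (n : ℝ) - 1 ≠ 0 := by linarith
    have hs : (n : ℝ) + 1 ≠ 0 := by linarith
    have hscale : ∀ x : ℝ, (1 - 2 / ((n : ℝ) + 1)) * (x / ((n : ℝ) * ((n : ℝ) - 1))) =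
        x / (((n : ℝ) + 1) * ((n : ℝ) + 1 - 1)) := by
      intro x
      rw [add_sub_cancel_right]
      field_simp
      ring
    rw [hrec (n + 1) (by omega), Nat.add_sub_cancel, ih, Finset.sum_Icc_succ_top (by omega)]
    push_cast
    have hlast : ((n : ℝ) + 1) * ((n : ℝ) + 1 - 1) / (((n : ℝ) + 1) * ((n : ℝ) + 1 - 1)) = 1 := by
      rw [add_sub_cancel_right]
      exact div_self (mul_ne_zero hs hn0)
    rw [mul_add, hscale, Finset.mul_sum, hlast, one_mul, add_assoc]
    congr 2
    refine Finset.sum_congr rfl fun j _ => ?_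
    simp only [← mul_assoc, hscale]
end

section
/- If δ ≥ 0, then for every integer i ≥ m', h(i) ≥ (m'(m'-1)/i²)·[ 1 + δ·( ln((i+1)/(m'+1)) - 1 + m'/i ) ]. -/
/-- If δ ≥ 0 then for every i ≥ m',
h(i) ≥ (m'(m'-1)/i²)·(1 + δ·(ln((i+1)/(m'+1)) - 1 + m'/i)). -/
theorem stmt_10 (m' : ℕ) (hm' : 3 ≤ m') (δ : ℝ) (hδ : 0 ≤ δ) (h : ℕ → ℝ)
    (hbase : h m' = 1)
    (hrec : ∀ i : ℕ, m' < i →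
      h i = (1 - 2 / (i : ℝ)) * h (i - 1) +
        (δ / (i : ℝ)) * ((m' : ℝ) * ((m' : ℝ) - 1) / (((i : ℝ) - 1) * ((i : ℝ) - 2))) *
          (1 - (m' : ℝ) / ((i : ℝ) - 1))) :
    ∀ i : ℕ, m' ≤ i →
      h i ≥ (m' : ℝ) * ((m' : ℝ) - 1) / (i : ℝ) ^ 2 *
        (1 + δ * (Real.log (((i : ℝ) + 1) / ((m' : ℝ) + 1)) - 1 + (m' : ℝ) / (i : ℝ))) := by
  have hm : (3 : ℝ) ≤ m' := by exact_mod_cast hm'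
  have key : ∀ i : ℕ, m' ≤ i → 0 ≤ h i ∧
      (m' : ℝ) * ((m' : ℝ) - 1) *
        (1 + δ * (Real.log (((i : ℝ) + 1) / ((m' : ℝ) + 1)) - 1 + (m' : ℝ) / (i : ℝ))) ≤
        (i : ℝ) * ((i : ℝ) - 1) * h i := by
    intro i hi
    induction i, hi using Nat.le_induction with
    | base =>
      have h0 : (m' : ℝ) ≠ 0 := by positivity
      have h1 : (m' : ℝ) + 1 ≠ 0 := by positivity
      simp [hbase, div_self h0, div_self h1]
    | succ n hn ih =>
      obtain ⟨ihpos, ih⟩ := ih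
      have hr := hrec (n + 1) (by omega)
      have hn' : (m' : ℝ) ≤ n := by exact_mod_cast hn
      simp only [Nat.add_sub_cancel] at hr
      push_cast at hr ⊢
      generalize (m' : ℝ) = m at *
      generalize (n : ℝ) = x at *
      have hx0 : 0 < x := by linarith
      have hx1 : 0 < x - 1 := by linarith
      have hM : 0 ≤ m * (m - 1) := mul_nonneg (by linarith) (by linarith)
      have e1 : x + 1 - 1 = x := by ring
      have e2 : x + 1 - 2 = x - 1 := by ring
      rw [e1, e2] at hr
      rw [e1]
      have hlog : Real.log ((x + 1 + 1) / (m + 1)) ≤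
          Real.log ((x + 1) / (m + 1)) + 1 / (x + 1) := by
        have hfac : (x + 1 + 1) / (m + 1) = (x + 1) / (m + 1) * (1 + 1 / (x + 1)) := by
          field_simp
        rw [hfac, Real.log_mul (by positivity) (by positivity)]
        have := Real.log_le_sub_one_of_pos (show 0 < 1 + 1 / (x + 1) by positivity)
        linarith
      have hstep : (x + 1) * x * h (n + 1) =
          x * (x - 1) * h n + m * (m - 1) * (δ * ((x - m) / (x * (x - 1)))) := by
        rw [hr]
        field_simp
        ring
      have hinc : 1 / (x + 1) + m / (x + 1) - m / x ≤ (x - m) / (x * (x - 1)) := by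
        have heq : 1 / (x + 1) + m / (x + 1) - m / x = (x - m) / (x * (x + 1)) := by
          field_simp
          ring
        rw [heq]
        gcongr
        linarith
      constructor
      · rw [hr]
        have h2 : 0 ≤ 1 - 2 / (x + 1) := by
          rw [sub_nonneg, div_le_one (by linarith)]
          linarith
        have h3 : 0 ≤ 1 - m / x := by
          rw [sub_nonneg, div_le_one hx0]
          exact hn'
        positivity
      · rw [hstep]
        calc m * (m - 1) * (1 + δ * (Real.log ((x + 1 + 1) / (m + 1)) - 1 + m / (x + 1)))
            ≤ m * (m - 1) * (1 + δ * (Real.log ((x + 1) / (m + 1)) - 1 + m / x +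
                (x - m) / (x * (x - 1)))) := by
              gcongr m * (m - 1) * (1 + δ * ?_)
              linarith
          _ ≤ _ := by linarith
  intro i hi
  obtain ⟨hpos, hle⟩ := key i hi
  have hi0 : (0 : ℝ) < i := by
    exact_mod_cast (by omega : 0 < i)
  rw [ge_iff_le, div_mul_eq_mul_div, div_le_iff₀ (by positivity)]
  nlinarith [mul_nonneg hi0.le hpos]
end

section
/- Fix a real number δ ≥ 0 and a real number α with 0 < α < 1. For each positive integer m, set m'(m) = ⌊αm⌋ and define h_m : ℕ → ℝ by h_m(m'(m)) = 1 and, for integers i > m'(m), h_m(i) = (1 - 2/i)·h_m(i-1) + (δ/i)·(m'(m)(m'(m)-1)/((i-1)(i-2)))·(1 - m'(m)/(i-1)). Then liminf_{m→∞} (1/m)·Σ_{i=m'(m)+1}^{m} h_m(i) ≥ α - α² + δ·α²·ln α + (δ/2)·(α - α³). -/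
open Filter Topology

/-- Closed form of the solution of the recursion started at `n` with value `1`. -/
theorem recursion_closed_form (δ : ℝ) (n : ℕ) (hn : 3 ≤ n) (f : ℕ → ℝ) (hbase : f n = 1)
    (hrec : ∀ i : ℕ, n < i → f i = (1 - 2 / (i : ℝ)) * f (i - 1) +
      (δ / (i : ℝ)) * ((n : ℝ) * ((n : ℝ) - 1) / (((i : ℝ) - 1) * ((i : ℝ) - 2))) *
        (1 - (n : ℝ) / ((i : ℝ) - 1))) (i : ℕ) (hi : n ≤ i) :
    f i = (n : ℝ) * (n - 1) / (i * (i - 1)) *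
      (1 + δ * ((harmonic i : ℝ) - 1 / i - 1 / (i - 1)
        - ((harmonic n : ℝ) - 1 / n - 1 / (n - 1)) - n / (n - 1) + n / (i - 1))) := by
  have hn' : (3 : ℝ) ≤ n := by exact_mod_cast hn
  have n0 : (n : ℝ) ≠ 0 := by linarith
  have n1 : (n : ℝ) - 1 ≠ 0 := by linarith
  induction i, hi using Nat.le_induction with
  | base =>
    rw [hbase]
    field_simp
    ring
  | succ i hi ih =>
    have hi' : (n : ℝ) ≤ i := by exact_mod_cast hi
    have i0 : (i : ℝ) ≠ 0 := by linarith
    have i1 : (i : ℝ) - 1 ≠ 0 := by linarith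
    have i2 : (i : ℝ) + 1 ≠ 0 := by linarith
    rw [hrec (i + 1) (by omega), Nat.add_sub_cancel, ih, harmonic_succ]
    push_cast
    rw [show (i : ℝ) + 1 - 1 = i by ring, show (i : ℝ) + 1 - 2 = i - 1 by ring]
    generalize (harmonic i : ℝ) = H
    generalize (harmonic n : ℝ) = K
    field_simp
    ring

/-- With `s = 1` a lower bound and with `s = -1` an upper bound for the sum of the solution of the
recursion over `(n, M]`. -/
noncomputable def sumBound (δ : ℝ) (n M : ℕ) (s : ℝ) : ℝ :=
  (n : ℝ) * (n - 1) * ((1 - δ * (n / (n - 1))) * (1 / n - 1 / M)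
    + δ * ((1 / (n - 1) + 1) / n
      - ((harmonic M : ℝ) - 1 / M - harmonic n + 1 / n + 1 / (n - 1) + 1) / M)
    + δ * n * (1 / 2 * (1 / (n * (n + s)) - 1 / (M * (M + s)))))

theorem sumBound_self (δ : ℝ) (n : ℕ) (s : ℝ) : sumBound δ n n s = 0 := by
  unfold sumBound
  ring

/-- The increment of `sumBound` agrees with the closed form up to the replacement of
`1 / ((M + 1) * M ^ 2)` by a telescoping term. -/
theorem sumBound_succ (δ : ℝ) (n M : ℕ) (hn : 3 ≤ n) (hM : n ≤ M) (s : ℝ) :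
    sumBound δ n (M + 1) s = sumBound δ n M s + (n : ℝ) * (n - 1) / ((M + 1) * M) *
      (1 + δ * ((harmonic (M + 1) : ℝ) - 1 / (M + 1) - 1 / M
        - ((harmonic n : ℝ) - 1 / n - 1 / (n - 1)) - n / (n - 1) + n / M))
      + (n : ℝ) * (n - 1) * δ * n *
        (1 / 2 * (1 / (M * (M + s)) - 1 / ((M + 1) * (M + 1 + s))) - 1 / ((M + 1) * M * M)) := by
  have hn' : (3 : ℝ) ≤ n := by exact_mod_cast hn
  have hM' : (n : ℝ) ≤ M := by exact_mod_cast hM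
  have n0 : (n : ℝ) ≠ 0 := by linarith
  have n1 : (n : ℝ) - 1 ≠ 0 := by linarith
  have M0 : (M : ℝ) ≠ 0 := by linarith
  have M2 : (M : ℝ) + 1 ≠ 0 := by linarith
  unfold sumBound
  rw [harmonic_succ]
  push_cast
  generalize (harmonic M : ℝ) = H
  generalize (harmonic n : ℝ) = K
  generalize 1 / ((n : ℝ) * (n + s)) = A
  generalize 1 / ((M : ℝ) * (M + s)) = B
  generalize 1 / (((M : ℝ) + 1) * (M + 1 + s)) = C
  field_simp
  ring

theorem sum_mem_sumBound (δ : ℝ) (hδ : 0 ≤ δ) (n : ℕ) (hn : 3 ≤ n) (f : ℕ → ℝ)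
    (hf : ∀ i : ℕ, n ≤ i → f i = (n : ℝ) * (n - 1) / (i * (i - 1)) *
      (1 + δ * ((harmonic i : ℝ) - 1 / i - 1 / (i - 1)
        - ((harmonic n : ℝ) - 1 / n - 1 / (n - 1)) - n / (n - 1) + n / (i - 1))))
    (M : ℕ) (hM : n ≤ M) :
    sumBound δ n M 1 ≤ ∑ i ∈ Finset.Icc (n + 1) M, f i ∧
      ∑ i ∈ Finset.Icc (n + 1) M, f i ≤ sumBound δ n M (-1) := by
  induction M, hM using Nat.le_induction with
  | base => simp [sumBound_self]
  | succ M hM ih =>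
    have hn' : (3 : ℝ) ≤ n := by exact_mod_cast hn
    have hM' : (n : ℝ) ≤ M := by exact_mod_cast hM
    have M0 : (0 : ℝ) < M := by linarith
    have M1 : (0 : ℝ) < (M : ℝ) - 1 := by linarith
    have hc : 0 ≤ (n : ℝ) * (n - 1) * δ * n := by
      have : (0 : ℝ) ≤ (n : ℝ) - 1 := by linarith
      positivity
    have hlo : (1 : ℝ) / 2 * (1 / (M * (M + 1)) - 1 / ((M + 1) * (M + 1 + 1)))
        - 1 / ((M + 1) * M * M) ≤ 0 := by
      have : (1 : ℝ) / 2 * (1 / (M * (M + 1)) - 1 / ((M + 1) * (M + 1 + 1)))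
        - 1 / ((M + 1) * M * M) = - (2 / ((M + 1) * M * M * (M + 2))) := by
        have : (M : ℝ) + 1 + 1 ≠ 0 := by positivity
        field_simp
        ring
      rw [this]
      have : (0 : ℝ) ≤ 2 / ((M + 1) * M * M * (M + 2)) := by positivity
      linarith
    have hhi : 0 ≤ (1 : ℝ) / 2 * (1 / (M * (M + -1)) - 1 / ((M + 1) * (M + 1 + -1)))
        - 1 / ((M + 1) * M * M) := by
      have : (1 : ℝ) / 2 * (1 / (M * (M + -1)) - 1 / ((M + 1) * (M + 1 + -1)))
        - 1 / ((M + 1) * M * M) = 1 / ((M + 1) * M * M * (M - 1)) := by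
        rw [show (M : ℝ) + 1 + -1 = M by ring, show (M : ℝ) + -1 = M - 1 by ring]
        field_simp
        ring
      rw [this]
      positivity
    have hlo' := mul_nonpos_of_nonneg_of_nonpos hc hlo
    have hhi' := mul_nonneg hc hhi
    have hv := hf (M + 1) (by omega)
    push_cast at hv
    rw [show (M : ℝ) + 1 - 1 = M by ring] at hv
    rw [Finset.sum_Icc_succ_top (by omega), sumBound_succ δ n M hn hM,
      sumBound_succ δ n M hn hM, hv]
    constructor <;> linarith [ih.1, ih.2]

theorem tendsto_harmonic_sub_harmonic_floor_mul (α : ℝ) (hα0 : 0 < α) :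
    Tendsto (fun m : ℕ => (harmonic m : ℝ) - harmonic ⌊α * m⌋₊) atTop (𝓝 (-Real.log α)) := by
  have hfl : Tendsto (fun m : ℕ => ⌊α * m⌋₊) atTop atTop :=
    tendsto_nat_floor_atTop.comp (tendsto_natCast_atTop_atTop.const_mul_atTop hα0)
  have hdiv : Tendsto (fun m : ℕ => (⌊α * m⌋₊ : ℝ) / m) atTop (𝓝 α) :=
    (tendsto_nat_floor_mul_div_atTop hα0.le).comp tendsto_natCast_atTop_atTop
  have h1 := Real.tendsto_harmonic_sub_log
  have h2 := (h1.sub (h1.comp hfl)).sub (hdiv.log hα0.ne')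
  rw [sub_self, zero_sub] at h2
  refine h2.congr' ?_
  filter_upwards [eventually_ge_atTop 1, hfl.eventually_ge_atTop 1] with m hm hn
  have hm' : (m : ℝ) ≠ 0 := by positivity
  have hn' : (⌊α * m⌋₊ : ℝ) ≠ 0 := by positivity
  rw [Real.log_div hn' hm']
  simp only [Function.comp_apply]
  ring

theorem tendsto_sumBound_div (δ α : ℝ) (hα0 : 0 < α) (s : ℝ) :
    Tendsto (fun m : ℕ => 1 / (m : ℝ) * sumBound δ ⌊α * m⌋₊ m s) atTop
      (𝓝 (α - α ^ 2 + δ * α ^ 2 * Real.log α + (δ / 2) * (α - α ^ 3))) := by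
  have hfl : Tendsto (fun m : ℕ => ⌊α * m⌋₊) atTop atTop :=
    tendsto_nat_floor_atTop.comp (tendsto_natCast_atTop_atTop.const_mul_atTop hα0)
  have ha : Tendsto (fun m : ℕ => (⌊α * m⌋₊ : ℝ) / m) atTop (𝓝 α) :=
    (tendsto_nat_floor_mul_div_atTop hα0.le).comp tendsto_natCast_atTop_atTop
  have hb : Tendsto (fun m : ℕ => 1 / (m : ℝ)) atTop (𝓝 0) := tendsto_one_div_atTop_nhds_zero_nat
  have hD := tendsto_harmonic_sub_harmonic_floor_mul α hα0
  have hα : α ≠ 0 := hα0.ne'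
  have key : Tendsto (fun p : ℝ × ℝ × ℝ => p.1 * (p.1 - p.2.1) *
      ((1 - δ * (p.1 / (p.1 - p.2.1))) * (1 / p.1 - 1)
        + δ * ((p.2.1 / (p.1 - p.2.1) + 1) / p.1
          - (p.2.2 - p.2.1 + p.2.1 / p.1 + p.2.1 / (p.1 - p.2.1) + 1))
        + δ * (1 / 2 * (1 / (p.1 + s * p.2.1) - p.1 / (1 + s * p.2.1)))))
      (𝓝 (α, 0, -Real.log α))
      (𝓝 (α - α ^ 2 + δ * α ^ 2 * Real.log α + (δ / 2) * (α - α ^ 3))) := by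
    have hc : ContinuousAt (fun p : ℝ × ℝ × ℝ => p.1 * (p.1 - p.2.1) *
      ((1 - δ * (p.1 / (p.1 - p.2.1))) * (1 / p.1 - 1)
        + δ * ((p.2.1 / (p.1 - p.2.1) + 1) / p.1
          - (p.2.2 - p.2.1 + p.2.1 / p.1 + p.2.1 / (p.1 - p.2.1) + 1))
        + δ * (1 / 2 * (1 / (p.1 + s * p.2.1) - p.1 / (1 + s * p.2.1)))))
        (α, 0, -Real.log α) := by
      fun_prop (disch := simp [hα])
    convert hc.tendsto using 2
    simp only [mul_zero, add_zero, sub_zero, zero_div, div_one]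
    field_simp
    ring
  have hlim := key.comp (ha.prodMk_nhds (hb.prodMk_nhds hD))
  have hs : ∀ᶠ x : ℕ in atTop, 1 + |s| < (x : ℝ) :=
    tendsto_natCast_atTop_atTop.eventually_gt_atTop _
  refine hlim.congr' ?_
  filter_upwards [hs, hfl.eventually hs] with m hm hn
  have hs0 := neg_abs_le s
  have hs1 := abs_nonneg s
  simp only [Function.comp_apply, sumBound]
  generalize (⌊α * m⌋₊ : ℕ) = k at *
  generalize (harmonic m : ℝ) = H
  generalize (harmonic k : ℝ) = K
  generalize (m : ℝ) = x at *
  generalize (k : ℝ) = y at *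
  have x0 : x ≠ 0 := by linarith
  have y0 : y ≠ 0 := by linarith
  have y1 : y - 1 ≠ 0 := by linarith
  have xs : x + s ≠ 0 := by linarith
  have ys : y + s ≠ 0 := by linarith
  rw [show y / x - 1 / x = (y - 1) / x by ring,
    show y / x + s * (1 / x) = (y + s) / x by ring,
    show 1 + s * (1 / x) = (x + s) / x by field_simp]
  field_simp
  ring

/-- With m'(m) = ⌊αm⌋ and h_m defined recursively, the liminf of
(1/m)·Σ_{i=m'(m)+1}^m h_m(i) is at least α - α² + δα²·ln α + (δ/2)(α - α³). -/
theorem stmt_11 (δ : ℝ) (hδ : 0 ≤ δ) (α : ℝ) (hα0 : 0 < α) (hα1 : α < 1)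
    (h : ℕ → ℕ → ℝ)
    (hbase : ∀ m : ℕ, 1 ≤ m → h m (⌊α * m⌋₊) = 1)
    (hrec : ∀ m : ℕ, 1 ≤ m → ∀ i : ℕ, ⌊α * m⌋₊ < i →
      h m i = (1 - 2 / (i : ℝ)) * h m (i - 1) +
        (δ / (i : ℝ)) *
          ((⌊α * m⌋₊ : ℝ) * ((⌊α * m⌋₊ : ℝ) - 1) / (((i : ℝ) - 1) * ((i : ℝ) - 2))) *
          (1 - (⌊α * m⌋₊ : ℝ) / ((i : ℝ) - 1))) :
    α - α ^ 2 + δ * α ^ 2 * Real.log α + (δ / 2) * (α - α ^ 3) ≤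
      Filter.liminf
        (fun m : ℕ => (1 / (m : ℝ)) * ∑ i ∈ Finset.Icc (⌊α * m⌋₊ + 1) m, h m i)
        Filter.atTop := by
  have hfl : Tendsto (fun m : ℕ => ⌊α * m⌋₊) atTop atTop :=
    tendsto_nat_floor_atTop.comp (tendsto_natCast_atTop_atTop.const_mul_atTop hα0)
  have hbounds : ∀ᶠ m : ℕ in atTop,
      sumBound δ ⌊α * m⌋₊ m 1 ≤ ∑ i ∈ Finset.Icc (⌊α * m⌋₊ + 1) m, h m i ∧
        ∑ i ∈ Finset.Icc (⌊α * m⌋₊ + 1) m, h m i ≤ sumBound δ ⌊α * m⌋₊ m (-1) := by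
    filter_upwards [eventually_ge_atTop 1, hfl.eventually_ge_atTop 3] with m hm hn
    refine sum_mem_sumBound δ hδ _ hn (h m)
      (recursion_closed_form δ _ hn (h m) (hbase m hm) (hrec m hm)) m ?_
    exact Nat.floor_le_of_le (mul_le_of_le_one_left m.cast_nonneg hα1.le)
  refine (Tendsto.liminf_eq ?_).ge
  refine tendsto_of_tendsto_of_tendsto_of_le_of_le' (tendsto_sumBound_div δ α hα0 1)
    (tendsto_sumBound_div δ α hα0 (-1)) ?_ ?_
  · filter_upwards [hbounds] with m hm
    exact mul_le_mul_of_nonneg_left hm.1 (by positivity)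
  · filter_upwards [hbounds] with m hm
    exact mul_le_mul_of_nonneg_left hm.2 (by positivity)
end

section
/- For all integers d, g, t with d ≥ 2, g ≥ 3 and t ≥ 4, there exist positive integers m and n with n ≥ t·m and a finite simple graph G of girth at least g whose vertex set can be partitioned into sets A and B with |A| = m and |B| = n, such that every edge of G has one endpoint in A and one endpoint in B, and every vertex of B has degree at least d in G. -/
open SimpleGraph Finset in
/-- Adding an edge between two vertices that are far apart creates no short cycle. -/
theorem le_egirth_sup_edge {V : Type*} {G : SimpleGraph V} {a b : V} {g : ℕ}
    (hG : (g : ℕ∞) ≤ G.egirth) (h : ∀ p : G.Walk a b, g ≤ p.length + 1) :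
    (g : ℕ∞) ≤ (G ⊔ edge a b).egirth := by
  rw [le_egirth] at hG ⊢
  intro u w hw
  have key : ∀ e ∈ w.edges, e ≠ s(a, b) → e ∈ G.edgeSet := by
    intro e he hne
    have := w.edges_subset_edgeSet he
    rw [edgeSet_sup] at this
    rcases this with h1 | h1
    · exact h1
    · exact absurd (edgeSet_edge_subset h1) hne
  by_cases hab : s(a, b) ∈ w.edges
  · obtain ⟨⟨⟨x, y⟩, hxy⟩, hd, hde⟩ := List.mem_map.mp hab
    obtain ⟨q, r, hqr⟩ := (Walk.isSubwalk_toWalk_iff_mem_darts w hxy).mpr hd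
    have hnd := hw.edges_nodup
    replace hde : s(x, y) = s(a, b) := hde
    have hlen : w.length = q.length + 1 + r.length := by simp [hqr, Walk.length_append]
    have hnot : s(a, b) ∉ (r.append q).edges := by
      rw [hqr] at hnd
      simp only [Walk.edges_append, Adj.toWalk, Walk.edges_cons, Walk.edges_nil, hde] at hnd
      simp only [Walk.edges_append]
      grind
    have hsub : ∀ e ∈ (r.append q).edges, e ∈ G.edgeSet := by
      intro e he
      refine key e ?_ (fun h' ↦ hnot (h' ▸ he))
      rw [hqr]
      simp only [Walk.edges_append, List.mem_append] at he ⊢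
      tauto
    let p : G.Walk y x := (r.append q).transfer G hsub
    have hp : p.length = r.length + q.length := by simp [p]
    have : g ≤ p.length + 1 := by
      rcases Sym2.eq_iff.mp hde with ⟨rfl, rfl⟩ | ⟨rfl, rfl⟩
      · simpa using h p.reverse
      · exact h p
    norm_cast
    omega
  · have hsub : ∀ e ∈ w.edges, e ∈ G.edgeSet := fun e he ↦ key e he fun h' ↦ hab (h' ▸ he)
    simpa using hG u (w.transfer G hsub) (hw.transfer hsub)

open SimpleGraph Finset in
/-- In a graph of maximum degree at most `D`, balls of radius `k` have at most `(D + 1) ^ k`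
elements. -/
theorem exists_finset_card_le_of_degree_le {V : Type*} [DecidableEq V] {G : SimpleGraph V}
    [G.LocallyFinite] {D : ℕ} (hD : ∀ v, G.degree v ≤ D) (k : ℕ) (v : V) :
    ∃ S : Finset V, #S ≤ (D + 1) ^ k ∧ ∀ u, ∀ p : G.Walk v u, p.length ≤ k → u ∈ S := by
  induction k generalizing v with
  | zero =>
    refine ⟨{v}, by simp, fun u p hp ↦ ?_⟩
    simp [Walk.eq_of_length_eq_zero (Nat.le_zero.mp hp)]
  | succ k ih =>
    choose S hS hS' using ih
    refine ⟨insert v ((G.neighborFinset v).biUnion S), ?_, fun u p hp ↦ ?_⟩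
    · calc #(insert v ((G.neighborFinset v).biUnion S))
          ≤ #((G.neighborFinset v).biUnion S) + 1 := card_insert_le _ _
        _ ≤ #(G.neighborFinset v) * (D + 1) ^ k + 1 := by
            gcongr
            exact card_biUnion_le_card_mul _ _ _ fun x _ ↦ hS x
        _ ≤ D * (D + 1) ^ k + (D + 1) ^ k := by
            gcongr
            · exact hD v
            · exact Nat.one_le_pow _ _ (Nat.succ_pos D)
        _ = (D + 1) ^ (k + 1) := by ring
    · cases p with
      | nil => simp
      | @cons _ w _ hvw q =>
        simp only [mem_insert, mem_biUnion, mem_neighborFinset]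
        exact Or.inr ⟨w, hvw, hS' w u q (by simpa using hp)⟩

open SimpleGraph Finset in
theorem SimpleGraph.IsAcyclic.card_edgeFinset_lt {V : Type*} [Fintype V] [Nonempty V]
    {G : SimpleGraph V} [Fintype G.edgeSet] (hG : G.IsAcyclic) :
    #G.edgeFinset < Fintype.card V := by
  classical
  obtain ⟨T, hGT, -, hT⟩ := (connected_top (V := V)).exists_isTree_le_of_le_of_isAcyclic le_top hG
  have := hT.card_edgeFinset
  have := card_le_card (edgeFinset_mono hGT)
  omega

open SimpleGraph Finset in
theorem degree_sup_edge_le {V : Type*} [DecidableEq V] {G : SimpleGraph V} {a b : V} (v : V)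
    [Fintype (G.neighborSet v)] [Fintype ((G ⊔ edge a b).neighborSet v)] :
    (G ⊔ edge a b).degree v ≤ G.degree v + if v = a ∨ v = b then 1 else 0 := by
  simp only [← card_neighborFinset_eq_degree]
  split_ifs with hv
  · have : (G ⊔ edge a b).neighborFinset v ⊆
        insert (if v = a then b else a) (G.neighborFinset v) := by
      intro x
      simp only [mem_neighborFinset, sup_adj, edge_adj, mem_insert]
      grind
    exact (card_le_card this).trans (card_insert_le _ _)
  · refine card_le_card fun x ↦ ?_
    simp only [mem_neighborFinset, sup_adj, edge_adj]
    tauto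

open SimpleGraph Finset Classical in
/-- The graph is chosen maximal among the bipartite graphs of large girth with degrees at most
`2 * d * t` on `A` and at most `d` on `B`. -/
theorem exists_isBipartiteWith_le_egirth {V : Type*} [Fintype V] {A B : Finset V}
    (hAB : Disjoint A B) (huniv : ∀ v, v ∈ A ∨ v ∈ B) {d g t : ℕ} (hd : 0 < d) (hg : 0 < g)
    (ht : 0 < t)
    (hA : #A = 2 * (2 * d * t + 1) ^ g + 1) (hB : #B = t * #A) :
    ∃ G : SimpleGraph V, G.IsBipartiteWith A B ∧ (g : ℕ∞) ≤ G.egirth ∧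
      ∀ v ∈ B, G.degree v = d := by
  let P : SimpleGraph V → Prop := fun G ↦ G.IsBipartiteWith A B ∧ (g : ℕ∞) ≤ G.egirth ∧
    (∀ v ∈ A, G.degree v ≤ 2 * d * t) ∧ ∀ v ∈ B, G.degree v ≤ d
  have hbot : P ⊥ :=
    ⟨⟨disjoint_coe.mpr hAB, by simp⟩, by simp, by simp, by simp⟩
  obtain ⟨G, -, ⟨hbip, hgirth, hdA, hdB⟩, hmax⟩ := (Set.toFinite {G | P G}).exists_le_maximal hbot
  refine ⟨G, hbip, hgirth, fun b hb ↦ (hdB b hb).antisymm ?_⟩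
  by_contra! hlt
  have hdeg : ∀ v, G.degree v ≤ 2 * d * t := by
    intro v
    rcases huniv v with hv | hv
    · exact hdA v hv
    · exact (hdB v hv).trans (by nlinarith)
  obtain ⟨S, hS, hS'⟩ := exists_finset_card_le_of_degree_le hdeg g b
  obtain ⟨a, ha, haS, had⟩ : ∃ a ∈ A, a ∉ S ∧ G.degree a < 2 * d * t := by
    by_contra! hfull
    have h1 : #(A \ S) * (2 * d * t) ≤ ∑ v ∈ A \ S, G.degree v := by
      rw [← smul_eq_mul]
      refine card_nsmul_le_sum _ _ _ fun v hv ↦ ?_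
      rw [mem_sdiff] at hv
      exact hfull v hv.1 hv.2
    have h2 : ∑ v ∈ A \ S, G.degree v ≤ ∑ v ∈ A, G.degree v :=
      sum_le_sum_of_subset sdiff_subset
    have h3 : ∑ v ∈ A, G.degree v = ∑ v ∈ B, G.degree v := isBipartiteWith_sum_degrees_eq hbip
    have h4 : ∑ v ∈ B, G.degree v ≤ #B * d := by
      rw [← smul_eq_mul]
      exact sum_le_card_nsmul _ _ _ hdB
    have h5 : #A ≤ #(A \ S) + #S := by
      have := le_card_sdiff S A
      omega
    have h6 : (#A + 1) * (d * t) ≤ #(A \ S) * (2 * d * t) := by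
      have : #A + 1 ≤ #(A \ S) * 2 := by omega
      nlinarith [Nat.mul_le_mul_right (d * t) this]
    have h7 : 0 < d * t := by positivity
    rw [hB] at h4
    nlinarith
  have hne : a ≠ b := fun h ↦ haS (h ▸ hS' b .nil (by simp))
  have hadj : ¬ G.Adj a b := fun h ↦ haS (hS' a h.symm.toWalk (by simpa using Nat.succ_le_of_lt hg))
  have hP : P (G ⊔ edge a b) := by
    refine ⟨⟨disjoint_coe.mpr hAB, ?_⟩, le_egirth_sup_edge hgirth fun p ↦ ?_,
      fun v hv ↦ ?_, fun v hv ↦ ?_⟩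
    · intro v w hvw
      rcases hvw with h | h
      · exact hbip.mem_of_adj h
      · rw [edge_adj] at h
        rcases h.1 with ⟨rfl, rfl⟩ | ⟨rfl, rfl⟩
        · exact Or.inl ⟨ha, hb⟩
        · exact Or.inr ⟨hb, ha⟩
    · by_contra! hp
      exact haS (hS' a p.reverse (by simp; omega))
    · have hvb : v ≠ b := fun h ↦ disjoint_left.mp hAB hv (h ▸ hb)
      have h := degree_sup_edge_le (G := G) (a := a) (b := b) v
      refine le_trans (le_of_eq (by congr!)) (h.trans ?_)
      have := hdA v hv
      by_cases hva : v = a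
      · subst hva; simp at *; omega
      · simp [hva, hvb] at *; omega
    · have hva : v ≠ a := fun h ↦ disjoint_left.mp hAB ha (h ▸ hv)
      have h := degree_sup_edge_le (G := G) (a := a) (b := b) v
      refine le_trans (le_of_eq (by congr!)) (h.trans ?_)
      have := hdB v hv
      by_cases hvb : v = b
      · subst hvb; simp at *; omega
      · simp [hva, hvb] at *; omega
  exact (G.lt_sup_edge a b hne hadj).not_ge (hmax hP le_sup_left)

/-- For all d ≥ 2, g ≥ 3, t ≥ 4 there exist m, n with n ≥ t·m and a finite simple
graph of girth ≥ g whose vertices partition into A, B with |A| = m, |B| = n, all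
edges between A and B, and every vertex of B of degree ≥ d. -/
theorem stmt_14 (d g t : ℕ) (hd : 2 ≤ d) (hg : 3 ≤ g) (ht : 4 ≤ t) :
    ∃ (m n : ℕ), 0 < m ∧ 0 < n ∧ t * m ≤ n ∧
      ∃ (V : Type) (_ : Fintype V) (_ : DecidableEq V) (G : SimpleGraph V)
        (_ : DecidableRel G.Adj) (A B : Finset V),
        (g : ℕ∞) ≤ G.girth ∧
        Disjoint A B ∧ A ∪ B = Finset.univ ∧ A.card = m ∧ B.card = n ∧
        (∀ u v : V, G.Adj u v → (u ∈ A ∧ v ∈ B) ∨ (u ∈ B ∧ v ∈ A)) ∧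
        (∀ v ∈ B, d ≤ G.degree v) := by
  classical
  obtain ⟨m, hm⟩ : ∃ m, m = 2 * (2 * d * t + 1) ^ g + 1 := ⟨_, rfl⟩
  have hm0 : 0 < m := by omega
  let A : Finset (Fin m ⊕ Fin (t * m)) := Finset.univ.map .inl
  let B : Finset (Fin m ⊕ Fin (t * m)) := Finset.univ.map .inr
  have hAB : Disjoint A B := by simp [A, B, Finset.disjoint_left]
  have huniv : A ∪ B = Finset.univ := by ext (x | x) <;> simp [A, B]
  have hA : A.card = m := by simp [A]
  have hB : B.card = t * m := by simp [B]
  obtain ⟨G, hbip, hgirth, hdeg⟩ := exists_isBipartiteWith_le_egirth (d := d) (g := g) (t := t)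
    hAB (fun v ↦ Finset.mem_union.mp (huniv ▸ Finset.mem_univ v)) (by omega) (by omega) (by omega)
    (hA.trans hm) (by rw [hB, hA])
  refine ⟨m, t * m, hm0, by positivity, le_rfl, _, inferInstance, inferInstance, G,
    inferInstance, A, B, ?_, hAB, huniv, hA, hB, fun u v h ↦ hbip.mem_of_adj h, fun v hv ↦ ?_⟩
  · have hcyc : ¬ G.IsAcyclic := by
      intro hac
      have : Nonempty (Fin m ⊕ Fin (t * m)) := ⟨.inl ⟨0, hm0⟩⟩
      have h1 := hac.card_edgeFinset_lt
      have h2 := SimpleGraph.isBipartiteWith_sum_degrees_eq_card_edges' hbip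
      have h3 : ∑ v ∈ B, G.degree v = t * m * d := by
        refine (Finset.sum_const_nat fun v hv ↦ ?_).trans (congrArg (· * d) hB)
        convert hdeg v hv
      rw [← h2, h3] at h1
      simp only [Fintype.card_sum, Fintype.card_fin] at h1
      nlinarith [Nat.mul_le_mul_left (t * m) hd, Nat.mul_le_mul_right m ht]
    rwa [SimpleGraph.girth, ENat.natCast_toNat (SimpleGraph.egirth_eq_top.not.mpr hcyc)]
  · refine le_of_eq ?_
    convert (hdeg v hv).symm
end

section
/- Let T be a finite simple acyclic graph (a forest) whose vertex set is partitioned into two sets A and B such that every edge of T has one endpoint in A and one endpoint in B. Let Bad = { u ∈ B : deg_T(u) ≥ 2 }. If Bad is nonempty, then |Bad| ≤ |A| - 1. -/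
namespace SimpleGraph

/-- A forest on a nonempty finite vertex set has fewer edges than vertices. -/
theorem IsAcyclic.card_edgeFinset_lt_s15 {V : Type*} [Fintype V] [Nonempty V] {G : SimpleGraph V}
    [Fintype G.edgeSet] (hG : G.IsAcyclic) : G.edgeFinset.card < Fintype.card V := by
  classical
  obtain ⟨F, hGF, -, hF⟩ := connected_top.exists_isTree_le_of_le_of_isAcyclic le_top hG
  rw [← hF.card_edgeFinset, Nat.lt_succ_iff]
  exact Finset.card_le_card (edgeFinset_mono hGF)

/-- In a bipartite forest on a nonempty vertex set whose vertices on one side all have degree at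
least two, that side is smaller than the other. -/
theorem IsAcyclic.card_lt_card_of_two_le_degree {V : Type*} [Fintype V] [Nonempty V]
    [DecidableEq V] {G : SimpleGraph V} [DecidableRel G.Adj] (hG : G.IsAcyclic) {s t : Finset V}
    (hst : G.IsBipartiteWith s t) (hcover : s ∪ t = Finset.univ)
    (hdeg : ∀ v ∈ t, 2 ≤ G.degree v) : t.card < s.card := by
  have hlt := hG.card_edgeFinset_lt_s15
  rw [← isBipartiteWith_sum_degrees_eq_card_edges' hst, ← Finset.card_univ, ← hcover,
    Finset.card_union_of_disjoint (Finset.disjoint_coe.mp hst.disjoint)] at hlt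
  have hle := Finset.card_nsmul_le_sum t (fun v => G.degree v) 2 hdeg
  rw [smul_eq_mul] at hle
  omega

end SimpleGraph

/-- Let T be a finite forest whose vertex set is partitioned into A and B with every
edge between A and B, and let Bad = {u ∈ B : deg_T(u) ≥ 2}. If Bad is nonempty,
then |Bad| ≤ |A| - 1. -/
theorem stmt_15 (V : Type) [Fintype V] [DecidableEq V]
    (T : SimpleGraph V) [DecidableRel T.Adj] (hT : T.IsAcyclic)
    (A B : Finset V) (hdisj : Disjoint A B) (hcover : A ∪ B = Finset.univ)
    (hbip : ∀ u v : V, T.Adj u v → (u ∈ A ∧ v ∈ B) ∨ (u ∈ B ∧ v ∈ A)) :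
    (B.filter fun u => 2 ≤ T.degree u).Nonempty →
      (B.filter fun u => 2 ≤ T.degree u).card ≤ A.card - 1 := by
  rintro ⟨b, hb⟩
  set C := B.filter fun u => 2 ≤ T.degree u
  have hdisjoint : ∀ v, v ∈ A → v ∉ B := fun _ hv => Finset.disjoint_left.mp hdisj hv
  have hCB : ∀ v ∈ C, v ∈ B := fun v hv => (Finset.mem_filter.mp hv).1
  let S : Set V := {v | v ∈ A ∪ C}
  have : DecidablePred (· ∈ S) := Classical.decPred _
  have : Nonempty S := ⟨⟨b, Finset.mem_union_right A hb⟩⟩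
  have hlt := (hT.induce S).card_lt_card_of_two_le_degree
    (s := A.subtype (· ∈ S)) (t := C.subtype (· ∈ S)) ?_ ?_ ?_
  · rw [Finset.card_subtype, Finset.card_subtype,
      Finset.filter_true_of_mem (s := C) (p := (· ∈ S)) fun _ hv => Finset.mem_union_right A hv,
      Finset.filter_true_of_mem (s := A) (p := (· ∈ S)) fun _ hv => Finset.mem_union_left C hv] at hlt
    exact Nat.le_sub_one_of_lt hlt
  · constructor
    · rw [Finset.disjoint_coe, Finset.disjoint_left]
      intro v hvA hvC
      exact hdisjoint v (Finset.mem_subtype.mp hvA) (hCB v (Finset.mem_subtype.mp hvC))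
    · intro v w hvw
      have hv : v.1 ∈ A ∪ C := v.2
      have hw : w.1 ∈ A ∪ C := w.2
      have := hbip v w hvw
      simp only [Finset.mem_coe, Finset.mem_subtype]
      grind
  · ext v
    simpa [-Subtype.coe_prop] using Finset.mem_union.mp v.2
  · intro v hv
    have hvC := Finset.mem_subtype.mp hv
    have hsub : T.neighborSet v ⊆ S := fun w hw => by
      have := hbip v w hw
      exact Finset.mem_union_left C (by grind)
    convert (Finset.mem_filter.mp hvC).2 using 1
    convert SimpleGraph.degree_induce_of_neighborSet_subset hsub
end

section
/- Let G be a finite connected simple graph whose number of edges is at most its number of vertices. Then any two cycles in G have the same edge set; that is, if W₁ and W₂ are closed walks in G each of which is a cycle, then the set of edges traversed by W₁ equals the set of edges traversed by W₂. -/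
namespace SimpleGraph

/-- In a connected graph with at most as many edges as vertices, every edge of a cycle lies on
every other cycle. -/
lemma Connected.edges_subset_edges_of_isCycle {V : Type*} [Finite V] {G : SimpleGraph V}
    (hconn : G.Connected) (hcard : Nat.card G.edgeSet ≤ Nat.card V)
    {u v : V} {p : G.Walk u u} {q : G.Walk v v} (hp : p.IsCycle) (hq : q.IsCycle) :
    p.edges ⊆ q.edges := by
  intro e hep
  by_contra heq
  have he : e ∈ G.edgeSet := p.edges_subset_edgeSet hep
  have hbr : ¬ G.IsBridge e := fun h ↦ (isBridge_iff_forall_cycle_notMem he).mp h p hp hep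
  have hconn' : (G.deleteEdges {e}).Connected := by
    induction e with | h x y => exact hconn.connected_delete_edge_of_not_isBridge hbr
  have hlt : Nat.card (G.deleteEdges {e}).edgeSet + 1 = Nat.card G.edgeSet := by
    rw [edgeSet_deleteEdges]
    exact Set.ncard_sdiff_singleton_add_one he
  have hge := hconn'.card_vert_le_card_edgeSet_add_one
  have htree : (G.deleteEdges {e}).IsTree :=
    isTree_iff_connected_and_card.mpr ⟨hconn', by omega⟩
  exact htree.isAcyclic _ (hq.toDeleteEdges G {e} fun f hf hfe ↦ heq (hfe ▸ hf))

end SimpleGraph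

/-- If G is a finite connected simple graph with at most as many edges as vertices,
then any two cycles in G have the same edge set. -/
theorem stmt_16 (V : Type) [Fintype V] [DecidableEq V]
    (G : SimpleGraph V) [DecidableRel G.Adj]
    (hconn : G.Connected) (hcard : G.edgeFinset.card ≤ Fintype.card V)
    (u v : V) (W₁ : G.Walk u u) (W₂ : G.Walk v v)
    (h₁ : W₁.IsCycle) (h₂ : W₂.IsCycle) :
    W₁.edges.toFinset = W₂.edges.toFinset := by
  have hcard' : Nat.card G.edgeSet ≤ Nat.card V := by
    rwa [Nat.card_eq_fintype_card, Nat.card_eq_fintype_card, ← SimpleGraph.edgeFinset_card]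
  ext e
  simp only [List.mem_toFinset]
  exact ⟨fun h ↦ hconn.edges_subset_edges_of_isCycle hcard' h₁ h₂ h,
    fun h ↦ hconn.edges_subset_edges_of_isCycle hcard' h₂ h₁ h⟩
end

section
/- For every integer m ≥ 3, (1/m) · Σ_{t = ⌊m/e⌋+1}^{m} (⌊m/e⌋ + 1)/(t - 1) ≥ 1/e - 2e/m, where e is Euler's number. (This is the probability bound showing that every optimal edge is added to the auxiliary set A* with probability at least 1/e - 2e/m.) -/
/-- The logarithm `log (n / k)` is a lower bound for `1 / k + ⋯ + 1 / (n - 1)`. -/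
theorem log_sub_log_le_sum_one_div_sub_one {k n : ℕ} (hk : 1 ≤ k) (hkn : k ≤ n) :
    Real.log n - Real.log k ≤ ∑ t ∈ Finset.Icc (k + 1) n, 1 / ((t : ℝ) - 1) := by
  induction n, hkn using Nat.le_induction with
  | base => simp
  | succ n hkn ih =>
    have hn : (0 : ℝ) < n := by exact_mod_cast hk.trans hkn
    have hstep : Real.log (n + 1) - Real.log n ≤ 1 / n := by
      rw [← Real.log_div (by positivity) hn.ne']
      refine (Real.log_le_sub_one_of_pos (by positivity)).trans_eq ?_
      field_simp
      ring
    rw [Finset.sum_Icc_succ_top (by omega)]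
    push_cast
    rw [add_sub_cancel_right]
    linarith

/-- For every m ≥ 3, (1/m)·Σ_{t=⌊m/e⌋+1}^m (⌊m/e⌋+1)/(t-1) ≥ 1/e - 2e/m. -/
theorem stmt_18 (m : ℕ) (hm : 3 ≤ m) :
    (1 / (m : ℝ)) *
        ∑ t ∈ Finset.Icc (⌊(m : ℝ) / Real.exp 1⌋₊ + 1) m,
          ((⌊(m : ℝ) / Real.exp 1⌋₊ : ℝ) + 1) / ((t : ℝ) - 1) ≥
      1 / Real.exp 1 - 2 * Real.exp 1 / (m : ℝ) := by
  set k := ⌊(m : ℝ) / Real.exp 1⌋₊ with hk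
  have he : (0 : ℝ) < Real.exp 1 := Real.exp_pos 1
  have hm' : (3 : ℝ) ≤ m := by exact_mod_cast hm
  have hm0 : (0 : ℝ) < m := by linarith
  have hk1 : 1 ≤ k := by
    rw [hk, Nat.one_le_floor_iff, one_le_div he]
    linarith [Real.exp_one_lt_three]
  have hk0 : (0 : ℝ) < k := by exact_mod_cast hk1
  have hkle : (k : ℝ) ≤ m / Real.exp 1 := Nat.floor_le (by positivity)
  have hklt : (m : ℝ) / Real.exp 1 < k + 1 := Nat.lt_floor_add_one _
  have hkm : k ≤ m := by
    have : (m : ℝ) / Real.exp 1 ≤ m := div_le_self hm0.le (Real.one_le_exp zero_le_one)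
    exact_mod_cast hkle.trans this
  have hlog : Real.log k ≤ Real.log m - 1 := by
    have h := Real.log_le_log hk0 hkle
    rwa [Real.log_div hm0.ne' he.ne', Real.log_exp] at h
  have hsum : (1 : ℝ) ≤ ∑ t ∈ Finset.Icc (k + 1) m, 1 / ((t : ℝ) - 1) := by
    linarith [log_sub_log_le_sum_one_div_sub_one hk1 hkm]
  have hbound : (m : ℝ) / Real.exp 1 ≤
      ∑ t ∈ Finset.Icc (k + 1) m, ((k : ℝ) + 1) / ((t : ℝ) - 1) := by
    simp_rw [div_eq_mul_one_div ((k : ℝ) + 1), ← Finset.mul_sum]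
    nlinarith
  calc 1 / Real.exp 1 - 2 * Real.exp 1 / (m : ℝ) ≤ 1 / Real.exp 1 :=
        sub_le_self _ (by positivity)
    _ = 1 / (m : ℝ) * (m / Real.exp 1) := by field_simp
    _ ≤ _ := mul_le_mul_of_nonneg_left hbound (by positivity)
end
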